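/- arXiv:1507.05883 — 7 statements merged into one kernel-verified Lean document; each statement's English description precedes it below -/
import Mathlib

section
/- Let n ≥ 1, let L : ℝⁿ × ℝⁿ → ℝ be C¹, let k ∈ ℝ and let x : [0,1] → ℝⁿ be a C¹ curve. Then the function T ↦ A_k(x,T) = T·∫₀¹ [L(x(s), x'(s)/T) + k] ds is differentiable on (0,∞), and for every T > 0 its derivative equals ∫₀¹ [k − E(x(s), x'(s)/T)] ds; equivalently, setting γ(t) = x(t/T), the derivative equals (1/T)·∫₀ᵀ [k − E(γ(t), γ'(t))] dt. -/
open MeasureTheory intervalIntegral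

/-- The energy associated with a Lagrangian `L` in local coordinates:
`E(q,v) = ∂_v L(q,v)[v] - L(q,v)`. -/
noncomputable def energy {n : ℕ} (L : EuclideanSpace ℝ (Fin n) × EuclideanSpace ℝ (Fin n) → ℝ)
    (q v : EuclideanSpace ℝ (Fin n)) : ℝ :=
  fderiv ℝ (fun w => L (q, w)) v v - L (q, v)

/-- The free-time action `A_k(x,T) = T ∫₀¹ [L(x(s), x'(s)/T) + k] ds`. -/
noncomputable def freeTimeAction {n : ℕ} (L : EuclideanSpace ℝ (Fin n) × EuclideanSpace ℝ (Fin n) → ℝ)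
    (k : ℝ) (x : ℝ → EuclideanSpace ℝ (Fin n)) (T : ℝ) : ℝ :=
  T * ∫ s in (0:ℝ)..1, (L (x s, T⁻¹ • deriv x s) + k)

/-- Differentiation under the integral sign over a compact interval, for an integrand whose
parameter derivative is jointly continuous. -/
theorem hasDerivAt_intervalIntegral_of_continuous_uncurry {F F' : ℝ → ℝ → ℝ} {a b c : ℝ}
    (hF : ∀ c, Continuous (F c)) (hF' : Continuous (Function.uncurry F'))
    (hd : ∀ c s, HasDerivAt (fun y => F y s) (F' c s) c) :
    HasDerivAt (fun y => ∫ s in a..b, F y s) (∫ s in a..b, F' c s) c := by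
  obtain ⟨C, hC⟩ := ((isCompact_closedBall c 1).prod isCompact_uIcc).exists_bound_of_continuousOn
    (hF'.continuousOn (s := Metric.closedBall c 1 ×ˢ Set.uIcc a b))
  refine (hasDerivAt_integral_of_dominated_loc_of_deriv_le
    (bound := fun _ => C) (Metric.ball_mem_nhds c one_pos)
    (Filter.Eventually.of_forall fun y => (hF y).aestronglyMeasurable)
    ((hF c).intervalIntegrable a b) ?_ ?_ intervalIntegrable_const ?_).2
  · exact (hF'.comp (Continuous.prodMk_right c)).aestronglyMeasurable
  · exact Filter.Eventually.of_forall fun s hs y hy =>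
      hC (y, s) ⟨Metric.ball_subset_closedBall hy, Set.uIoc_subset_uIcc hs⟩
  · exact Filter.Eventually.of_forall fun s _ y _ => hd y s

/-- The energy of a differentiable Lagrangian in terms of its total derivative. -/
theorem energy_eq_fderiv_apply {n : ℕ}
    {L : EuclideanSpace ℝ (Fin n) × EuclideanSpace ℝ (Fin n) → ℝ}
    (hL : Differentiable ℝ L) (q v : EuclideanSpace ℝ (Fin n)) :
    energy L q v = fderiv ℝ L (q, v) (0, v) - L (q, v) := by
  have h : HasFDerivAt (fun w => L (q, w)) _ v :=
    (hL (q, v)).hasFDerivAt.comp v (hasFDerivAt_prodMk_right q v)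
  simp [energy, h.fderiv]

/-- For a `C¹` Lagrangian and a `C¹` curve, the function `T ↦ A_k(x,T)` is differentiable
on `(0,∞)` with derivative `∫₀¹ [k - E(x(s), x'(s)/T)] ds`, which, setting `γ(t) = x(t/T)`,
equals `(1/T) ∫₀ᵀ [k - E(γ(t), γ'(t))] dt`. -/
theorem derivative_of_freeTimeAction_in_T
    (n : ℕ) (hn : 1 ≤ n)
    (L : EuclideanSpace ℝ (Fin n) × EuclideanSpace ℝ (Fin n) → ℝ) (hL : ContDiff ℝ 1 L)
    (k : ℝ) (x : ℝ → EuclideanSpace ℝ (Fin n)) (hx : ContDiff ℝ 1 x)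
    (T : ℝ) (hT : 0 < T) :
    HasDerivAt (fun T' => freeTimeAction L k x T')
      (∫ s in (0:ℝ)..1, (k - energy L (x s) (T⁻¹ • deriv x s))) T
    ∧ (∫ s in (0:ℝ)..1, (k - energy L (x s) (T⁻¹ • deriv x s)))
        = T⁻¹ * ∫ t in (0:ℝ)..T,
            (k - energy L (x (t / T)) (deriv (fun u => x (u / T)) t)) := by
  have hd : Differentiable ℝ L := hL.differentiable one_ne_zero
  have hcx : Continuous x := hx.continuous
  have hcx' : Continuous (deriv x) := hx.continuous_deriv le_rfl
  have hcL : Continuous L := hL.continuous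
  have hcL' : Continuous (fderiv ℝ L) := hL.continuous_fderiv one_ne_zero
  have hG : HasDerivAt (fun c : ℝ => ∫ s in (0:ℝ)..1, (L (x s, c • deriv x s) + k))
      (∫ s in (0:ℝ)..1, fderiv ℝ L (x s, T⁻¹ • deriv x s) (0, deriv x s)) T⁻¹ := by
    refine hasDerivAt_intervalIntegral_of_continuous_uncurry
      (F' := fun c s => fderiv ℝ L (x s, c • deriv x s) (0, deriv x s)) ?_ ?_ ?_
    · intro c
      fun_prop
    · unfold Function.uncurry
      fun_prop
    · intro c s
      have h : HasDerivAt (fun y : ℝ => (x s, y • deriv x s)) (0, deriv x s) c := by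
        simpa using (hasDerivAt_const c (x s)).prodMk ((hasDerivAt_id c).smul_const (deriv x s))
      exact ((hd _).hasFDerivAt.comp_hasDerivAt c h).add_const k
  constructor
  · have h := (hasDerivAt_id T).mul (hG.comp T (hasDerivAt_inv hT.ne'))
    refine h.congr_deriv ?_
    have hE : ∀ s, k - energy L (x s) (T⁻¹ • deriv x s) = (L (x s, T⁻¹ • deriv x s) + k)
        - T⁻¹ * fderiv ℝ L (x s, T⁻¹ • deriv x s) (0, deriv x s) := by
      intro s
      have h0 : ((0, T⁻¹ • deriv x s) : EuclideanSpace ℝ (Fin n) × EuclideanSpace ℝ (Fin n))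
          = T⁻¹ • (0, deriv x s) := by simp
      rw [energy_eq_fderiv_apply hd, h0, map_smul, smul_eq_mul]
      ring
    simp only [hE]
    rw [integral_sub (Continuous.intervalIntegrable (by fun_prop) _ _)
      (Continuous.intervalIntegrable (by fun_prop) _ _),
      intervalIntegral.integral_const_mul]
    simp only [Function.comp_apply, id]
    field_simp
    ring
  · have hγ : ∀ t, deriv (fun u => x (u / T)) t = T⁻¹ • deriv x (t / T) := by
      intro t
      simp only [div_eq_inv_mul]
      exact deriv_comp_mul_left T⁻¹ x t
    simp only [hγ]
    rw [integral_comp_div (fun s => k - energy L (x s) (T⁻¹ • deriv x s)) hT.ne',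
      zero_div, div_self hT.ne', smul_eq_mul, inv_mul_cancel_left₀ hT.ne']
end

section
/- Let n ≥ 1, let L : ℝⁿ × ℝⁿ → ℝ be continuous and suppose there exist a > 0 and b ∈ ℝ with L(q,v) ≥ a|v|² − b for all (q,v) ∈ ℝⁿ × ℝⁿ. Then for every k ∈ ℝ, every C¹ curve x : [0,1] → ℝⁿ and every T > 0, the free-time action satisfies A_k(x,T) ≥ (a/T)·ℓ(x)² + T·(k − b), where ℓ(x) = ∫₀¹ |x'(s)| ds is the length of x. In particular, for any sequence (x_h, T_h) of C¹ curves and positive times with T_h → 0, one has liminf_{h→∞} A_k(x_h, T_h) ≥ 0. -/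
open MeasureTheory Filter

/-- The length `ℓ(x) = ∫₀¹ |x'(s)| ds` of a `C¹` curve `x : [0,1] → ℝⁿ`. -/
noncomputable def curveLength {n : ℕ} (x : ℝ → EuclideanSpace ℝ (Fin n)) : ℝ :=
  ∫ s in (0:ℝ)..1, ‖deriv x s‖

/-- Cauchy–Schwarz on the unit interval: `(∫₀¹ f)² ≤ ∫₀¹ f²`. -/
theorem sq_intervalIntegral_le {f : ℝ → ℝ} (hf : Continuous f) :
    (∫ s in (0:ℝ)..1, f s) ^ 2 ≤ ∫ s in (0:ℝ)..1, f s ^ 2 := by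
  set m := ∫ s in (0:ℝ)..1, f s with hm
  have hnn : 0 ≤ ∫ s in (0:ℝ)..1, (f s - m) ^ 2 :=
    intervalIntegral.integral_nonneg zero_le_one fun s _ => sq_nonneg _
  have hexp : ∫ s in (0:ℝ)..1, (f s - m) ^ 2 = (∫ s in (0:ℝ)..1, f s ^ 2) - m ^ 2 := by
    have hfun : ∀ s, (f s - m) ^ 2 = f s ^ 2 - (2 * m * f s - m ^ 2) := fun s => by ring
    simp_rw [hfun]
    rw [intervalIntegral.integral_sub ((by fun_prop : Continuous fun s => f s ^ 2).intervalIntegrable _ _)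
        ((by fun_prop : Continuous fun s => 2 * m * f s - m ^ 2).intervalIntegrable _ _),
      intervalIntegral.integral_sub ((by fun_prop : Continuous fun s => 2 * m * f s).intervalIntegrable _ _)
        intervalIntegrable_const, intervalIntegral.integral_const_mul, ← hm]
    simp only [intervalIntegral.integral_const, sub_zero, one_smul]
    ring
  linarith

/-- A lower bound tending to `0` forces a nonnegative real `liminf`, also when the `liminf` takes
its default value `0` because the sequence is unbounded. -/
theorem liminf_nonneg_of_tendsto_zero_le {f g : ℕ → ℝ} (hg : Tendsto g atTop (nhds 0))
    (hgf : ∀ h, g h ≤ f h) : 0 ≤ liminf f atTop := by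
  rw [liminf_eq]
  by_cases hbdd : BddAbove {c | ∀ᶠ h in atTop, c ≤ f h}
  · refine le_of_forall_lt fun c hc => ?_
    obtain ⟨d, hcd, hd⟩ := exists_between hc
    refine hcd.trans_le (le_csSup hbdd ?_)
    filter_upwards [hg.eventually_const_lt hd] with h hh using hh.le.trans (hgf h)
  · rw [Real.sSup_of_not_bddAbove hbdd]

/-- The quadratic lower bound on `L` bounds the free-time action below through the length. -/
theorem le_freeTimeAction {n : ℕ}
    {L : EuclideanSpace ℝ (Fin n) × EuclideanSpace ℝ (Fin n) → ℝ} (hL : Continuous L)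
    {a : ℝ} (ha : 0 ≤ a) {b : ℝ}
    (hLab : ∀ q v : EuclideanSpace ℝ (Fin n), a * ‖v‖ ^ 2 - b ≤ L (q, v)) (k : ℝ)
    {x : ℝ → EuclideanSpace ℝ (Fin n)} (hx : ContDiff ℝ 1 x) {T : ℝ} (hT : 0 < T) :
    a / T * curveLength x ^ 2 + T * (k - b) ≤ freeTimeAction L k x T := by
  have hx' : Continuous (deriv x) := hx.continuous_deriv le_rfl
  have hxc : Continuous x := hx.continuous
  have hsq : curveLength x ^ 2 ≤ ∫ s in (0:ℝ)..1, ‖deriv x s‖ ^ 2 :=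
    sq_intervalIntegral_le hx'.norm
  have hmono : ∫ s in (0:ℝ)..1, (a / T ^ 2 * ‖deriv x s‖ ^ 2 + (k - b)) ≤
      ∫ s in (0:ℝ)..1, (L (x s, T⁻¹ • deriv x s) + k) := by
    refine intervalIntegral.integral_mono_on zero_le_one
      ((by fun_prop : Continuous _).intervalIntegrable _ _)
      ((by fun_prop : Continuous _).intervalIntegrable _ _) fun s _ => ?_
    have h := hLab (x s) (T⁻¹ • deriv x s)
    rw [norm_smul, mul_pow, Real.norm_eq_abs, sq_abs, inv_pow, ← mul_assoc,
      ← div_eq_mul_inv] at h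
    linarith
  rw [intervalIntegral.integral_add
    ((by fun_prop : Continuous _).intervalIntegrable _ _) intervalIntegrable_const,
    intervalIntegral.integral_const_mul, intervalIntegral.integral_const] at hmono
  simp only [sub_zero, one_smul] at hmono
  calc a / T * curveLength x ^ 2 + T * (k - b)
      ≤ a / T * (∫ s in (0:ℝ)..1, ‖deriv x s‖ ^ 2) + T * (k - b) := by gcongr
    _ = T * (a / T ^ 2 * (∫ s in (0:ℝ)..1, ‖deriv x s‖ ^ 2) + (k - b)) := by
        field_simp
    _ ≤ freeTimeAction L k x T := mul_le_mul_of_nonneg_left hmono hT.le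

/-- If `L(q,v) ≥ a|v|² - b`, then `A_k(x,T) ≥ (a/T)·ℓ(x)² + T(k-b)`; in particular, along any
sequence of curves whose times tend to `0`, the liminf of the actions is nonnegative. -/
theorem freeTimeAction_lower_bound_and_liminf
    (n : ℕ) (hn : 1 ≤ n)
    (L : EuclideanSpace ℝ (Fin n) × EuclideanSpace ℝ (Fin n) → ℝ) (hL : Continuous L)
    (a : ℝ) (ha : 0 < a) (b : ℝ)
    (hLab : ∀ q v : EuclideanSpace ℝ (Fin n), a * ‖v‖ ^ 2 - b ≤ L (q, v)) (k : ℝ) :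
    (∀ x : ℝ → EuclideanSpace ℝ (Fin n), ContDiff ℝ 1 x → ∀ T : ℝ, 0 < T →
      a / T * curveLength x ^ 2 + T * (k - b) ≤ freeTimeAction L k x T)
    ∧ (∀ (x : ℕ → ℝ → EuclideanSpace ℝ (Fin n)) (T : ℕ → ℝ),
        (∀ h, ContDiff ℝ 1 (x h)) → (∀ h, 0 < T h) → Tendsto T atTop (nhds 0) →
        0 ≤ liminf (fun h => freeTimeAction L k (x h) (T h)) atTop) := by
  refine ⟨fun x hx T hT => le_freeTimeAction hL ha.le hLab k hx hT, fun x T hx hT hT0 => ?_⟩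
  refine liminf_nonneg_of_tendsto_zero_le (g := fun h => T h * (k - b))
    (by simpa using hT0.mul_const (k - b)) fun h => ?_
  have hpos : 0 ≤ a / T h * curveLength (x h) ^ 2 :=
    mul_nonneg (div_pos ha (hT h)).le (sq_nonneg _)
  linarith [le_freeTimeAction hL ha.le hLab k (hx h) (hT h)]
end

section
/- Let ψ : ℝ → ℝ be continuous with 0 ≤ ψ(s) ≤ 1 for all s ∈ ℝ. Then for every k ≥ 1/8, every T > 0, and every C¹ loop γ = (γ₁, γ₂) : [0,T] → ℝ² with γ₁(0) = γ₁(T), one has ∫₀ᵀ [½(γ₁'(t)² + γ₂'(t)²) + ψ(γ₂(t))·γ₁'(t) + k] dt ≥ 0. -/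
open MeasureTheory

/-- For the magnetic Lagrangian `L((x,y),(v₁,v₂)) = ½(v₁² + v₂²) + ψ(y)v₁` with
`0 ≤ ψ ≤ 1`, every `C¹` loop (with periodic first coordinate) has nonnegative
`(L+k)`-action as soon as `k ≥ 1/8`: the bound `c_u(L) ≤ 1/8`. -/
theorem magnetic_action_nonneg_on_loops_of_k_ge_one_eighth
    (ψ : ℝ → ℝ) (hψc : Continuous ψ) (hψ : ∀ s, 0 ≤ ψ s ∧ ψ s ≤ 1)
    (k : ℝ) (hk : 1 / 8 ≤ k) (T : ℝ) (hT : 0 < T)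
    (γ₁ γ₂ : ℝ → ℝ) (hγ₁ : ContDiff ℝ 1 γ₁) (hγ₂ : ContDiff ℝ 1 γ₂)
    (hloop : γ₁ 0 = γ₁ T) :
    0 ≤ ∫ t in (0:ℝ)..T,
        (1 / 2 * ((deriv γ₁ t) ^ 2 + (deriv γ₂ t) ^ 2) + ψ (γ₂ t) * deriv γ₁ t + k) := by
  have hd₁ : Continuous (deriv γ₁) := hγ₁.continuous_deriv le_rfl
  have hd₂ : Continuous (deriv γ₂) := hγ₂.continuous_deriv le_rfl
  have hγ₂c : Continuous γ₂ := hγ₂.continuous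
  have hzero : ∫ t in (0:ℝ)..T, 1 / 2 * deriv γ₁ t = 0 := by
    rw [intervalIntegral.integral_const_mul,
      intervalIntegral.integral_deriv_eq_sub
        (fun t _ => (hγ₁.differentiable one_ne_zero) t) (hd₁.intervalIntegrable 0 T),
      hloop, sub_self, mul_zero]
  refine hzero.symm.trans_le ?_
  refine intervalIntegral.integral_mono_on hT.le ?_ ?_ fun t _ => ?_
  · exact Continuous.intervalIntegrable (by fun_prop) _ _
  · exact Continuous.intervalIntegrable (by fun_prop) _ _
  obtain ⟨h0, h1⟩ := hψ (γ₂ t)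
  -- Complete the square in `γ₁'`, using `|ψ - 1/2| ≤ 1/2`.
  nlinarith [sq_nonneg (deriv γ₁ t + (ψ (γ₂ t) - 1 / 2)), sq_nonneg (deriv γ₂ t),
    mul_nonneg h0 (sub_nonneg.2 h1)]
end

section
/- Let ψ : ℝ → ℝ be continuous with 0 ≤ ψ(s) ≤ 1 for all s, ψ(0) = 0 and ψ(1/2) = 1. Then for every k with 0 < k < 1/8 there exist T > 0 and a C¹ loop γ = (γ₁, γ₂) : [0,T] → ℝ² with γ(0) = γ(T) such that ∫₀ᵀ [½(γ₁'(t)² + γ₂'(t)²) + ψ(γ₂(t))·γ₁'(t) + k] dt < 0. -/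
open MeasureTheory

/-- The `x`-profile of a U-turn: it vanishes for `u ≤ 0` and equals `1 - 2 * u` for `u ≥ 1`, so
adding it to `u` reverses the direction of motion between times `0` and `1`. -/
noncomputable def turn (u : ℝ) : ℝ := Real.smoothTransition u * (1 - 2 * u)

lemma contDiff_turn : ContDiff ℝ 1 turn :=
  Real.smoothTransition.contDiff.mul (by fun_prop)

lemma deriv_smoothTransition_of_neg {u : ℝ} (hu : u < 0) : deriv Real.smoothTransition u = 0 := by
  have h : Real.smoothTransition =ᶠ[nhds u] fun _ => 0 := by
    filter_upwards [Iio_mem_nhds hu] with v hv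
    exact Real.smoothTransition.zero_of_nonpos (le_of_lt hv)
  rw [h.deriv_eq, deriv_const]

lemma deriv_smoothTransition_of_one_lt {u : ℝ} (hu : 1 < u) :
    deriv Real.smoothTransition u = 0 := by
  have h : Real.smoothTransition =ᶠ[nhds u] fun _ => 1 := by
    filter_upwards [Ioi_mem_nhds hu] with v hv
    exact Real.smoothTransition.one_of_one_le (le_of_lt hv)
  rw [h.deriv_eq, deriv_const]

lemma turn_of_nonpos {u : ℝ} (hu : u ≤ 0) : turn u = 0 := by
  simp [turn, Real.smoothTransition.zero_of_nonpos hu]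

lemma turn_of_one_le {u : ℝ} (hu : 1 ≤ u) : turn u = 1 - 2 * u := by
  simp [turn, Real.smoothTransition.one_of_one_le hu]

lemma deriv_turn_of_neg {u : ℝ} (hu : u < 0) : deriv turn u = 0 := by
  have h : turn =ᶠ[nhds u] fun _ => 0 := by
    filter_upwards [Iio_mem_nhds hu] with v hv
    exact turn_of_nonpos (le_of_lt hv)
  rw [h.deriv_eq, deriv_const]

lemma deriv_turn_of_one_lt {u : ℝ} (hu : 1 < u) : deriv turn u = -2 := by
  have h : turn =ᶠ[nhds u] fun v => 1 - 2 * v := by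
    filter_upwards [Ioi_mem_nhds hu] with v hv
    exact turn_of_one_le (le_of_lt hv)
  rw [h.deriv_eq]
  simp

/-- A continuous function that is bounded outside `[0, 1]` is bounded. -/
lemma exists_abs_le_of_continuous {f : ℝ → ℝ} (hf : Continuous f) {C : ℝ}
    (h0 : ∀ u < 0, |f u| ≤ C) (h1 : ∀ u > 1, |f u| ≤ C) : ∃ B, ∀ u, |f u| ≤ B := by
  obtain ⟨D, hD⟩ := (isCompact_Icc (a := (0 : ℝ)) (b := 1)).exists_bound_of_continuousOn
    hf.continuousOn
  refine ⟨max C D, fun u => ?_⟩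
  rcases lt_or_ge u 0 with hu | hu
  · exact (h0 u hu).trans (le_max_left _ _)
  rcases lt_or_ge 1 u with hu' | hu'
  · exact (h1 u hu').trans (le_max_left _ _)
  · exact (hD u ⟨hu, hu'⟩).trans (le_max_right _ _)

lemma exists_abs_deriv_smoothTransition_le : ∃ B, ∀ u, |deriv Real.smoothTransition u| ≤ B :=
  exists_abs_le_of_continuous (C := 0)
    ((Real.smoothTransition.contDiff (n := 1)).continuous_deriv le_rfl)
    (fun u hu => by simp [deriv_smoothTransition_of_neg hu])
    (fun u hu => by simp [deriv_smoothTransition_of_one_lt hu])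

lemma exists_abs_deriv_turn_le : ∃ B, ∀ u, |deriv turn u| ≤ B :=
  exists_abs_le_of_continuous (C := 2) (contDiff_turn.continuous_deriv le_rfl)
    (fun u hu => by simp [deriv_turn_of_neg hu])
    (fun u hu => by simp [deriv_turn_of_one_lt hu])

lemma intervalIntegral_le_const_mul {f : ℝ → ℝ} (hf : Continuous f) {a b c : ℝ} (hab : a ≤ b)
    (h : ∀ t ∈ Set.Ioo a b, f t ≤ c) : ∫ t in a..b, f t ≤ c * (b - a) := by
  have := intervalIntegral.integral_mono_on_of_le_Ioo hab (hf.intervalIntegrable (μ := volume) a b)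
    (continuous_const.intervalIntegrable a b) h
  rwa [intervalIntegral.integral_const, smul_eq_mul, mul_comm] at this


/-- For the magnetic Lagrangian `L((x,y),(v₁,v₂)) = ½(v₁² + v₂²) + ψ(y)v₁` with
`0 ≤ ψ ≤ 1`, `ψ(0) = 0` and `ψ(1/2) = 1`, for every `0 < k < 1/8` there is a `C¹` loop
with negative `(L+k)`-action: the bound `c_u(L) ≥ 1/8`. -/
theorem magnetic_exists_loop_with_negative_action_of_k_lt_one_eighth
    (ψ : ℝ → ℝ) (hψc : Continuous ψ) (hψ : ∀ s, 0 ≤ ψ s ∧ ψ s ≤ 1)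
    (hψ0 : ψ 0 = 0) (hψhalf : ψ (1 / 2) = 1)
    (k : ℝ) (hk0 : 0 < k) (hk : k < 1 / 8) :
    ∃ (T : ℝ) (_ : 0 < T) (γ₁ γ₂ : ℝ → ℝ) (_ : ContDiff ℝ 1 γ₁) (_ : ContDiff ℝ 1 γ₂)
      (_ : γ₁ 0 = γ₁ T) (_ : γ₂ 0 = γ₂ T),
      (∫ t in (0:ℝ)..T,
        (1 / 2 * ((deriv γ₁ t) ^ 2 + (deriv γ₂ t) ^ 2) + ψ (γ₂ t) * deriv γ₁ t + k)) < 0 := by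
  obtain ⟨A, hA⟩ := exists_abs_deriv_smoothTransition_le
  obtain ⟨B, hB⟩ := exists_abs_deriv_turn_le
  set s := √(2 * k)
  have hs2 : s ^ 2 = 2 * k := Real.sq_sqrt (by linarith)
  have hs0 : 0 < s := Real.sqrt_pos.2 (by linarith)
  have hs_half : s < 1 / 2 := by nlinarith
  have hgain : 0 < s - 4 * k := by nlinarith
  set K := 1 / 2 * ((s * (1 + 2 * B)) ^ 2 + A ^ 2) + s * (1 + 2 * B) + k with hK
  obtain ⟨N, hN⟩ : ∃ N : ℝ, N = (2 * |K| + 1) / (s - 4 * k) := ⟨_, rfl⟩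
  have hN0 : 0 < N := by rw [hN]; positivity
  have hNK : N * (s - 4 * k) = 2 * |K| + 1 := by rw [hN]; field_simp
  set x : ℝ → ℝ := fun t => s * (t + turn (t - N) - turn (t - (2 * N + 1))) with hx
  set y : ℝ → ℝ := fun t => 1 / 2 *
    (Real.smoothTransition (t - N) - Real.smoothTransition (t - (2 * N + 1))) with hy
  have hσ : ContDiff ℝ 1 Real.smoothTransition := Real.smoothTransition.contDiff
  have hxC : ContDiff ℝ 1 x := contDiff_const.mul
    ((contDiff_id.add (contDiff_turn.comp (contDiff_id.sub contDiff_const))).sub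
      (contDiff_turn.comp (contDiff_id.sub contDiff_const)))
  have hyC : ContDiff ℝ 1 y := contDiff_const.mul
    ((hσ.comp (contDiff_id.sub contDiff_const)).sub (hσ.comp (contDiff_id.sub contDiff_const)))
  have hx' : ∀ t, deriv x t = s * (1 + deriv turn (t - N) - deriv turn (t - (2 * N + 1))) := by
    intro t
    have h (c : ℝ) :=
      ((contDiff_turn.differentiable one_ne_zero (t - c)).hasDerivAt).comp_sub_const t c
    exact ((((hasDerivAt_id t).add (h N)).sub (h (2 * N + 1))).const_mul s).deriv
  have hy' : ∀ t, deriv y t = 1 / 2 * (deriv Real.smoothTransition (t - N) -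
      deriv Real.smoothTransition (t - (2 * N + 1))) := by
    intro t
    have h (c : ℝ) := ((hσ.differentiable one_ne_zero (t - c)).hasDerivAt).comp_sub_const t c
    exact (((h N).sub (h (2 * N + 1))).const_mul (1 / 2)).deriv
  refine ⟨2 * N + 2, by linarith, x, y, hxC, hyC, ?_, ?_, ?_⟩
  · simp only [hx]
    rw [turn_of_nonpos (by linarith), turn_of_nonpos (by linarith), turn_of_one_le (by linarith),
      turn_of_one_le (by linarith)]
    ring
  · simp only [hy]
    rw [Real.smoothTransition.zero_of_nonpos (by linarith),
      Real.smoothTransition.zero_of_nonpos (by linarith),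
      Real.smoothTransition.one_of_one_le (by linarith),
      Real.smoothTransition.one_of_one_le (by linarith)]
    ring
  set E : ℝ → ℝ := fun t =>
    1 / 2 * ((deriv x t) ^ 2 + (deriv y t) ^ 2) + ψ (y t) * deriv x t + k with hE
  have hEc : Continuous E := by
    have h1 := hxC.continuous_deriv le_rfl
    have h2 := hyC.continuous_deriv le_rfl
    have h3 := hyC.continuous
    fun_prop
  have hEK : ∀ t, E t ≤ |K| := by
    intro t
    have hxb : |deriv x t| ≤ s * (1 + 2 * B) := by
      rw [hx', abs_mul, abs_of_pos hs0]
      have h1 := abs_le.1 (hB (t - N))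
      have h2 := abs_le.1 (hB (t - (2 * N + 1)))
      gcongr
      exact abs_le.2 ⟨by linarith, by linarith⟩
    have hyb : |deriv y t| ≤ A := by
      have h1 := abs_le.1 (hA (t - N))
      have h2 := abs_le.1 (hA (t - (2 * N + 1)))
      rw [hy']
      exact abs_le.2 ⟨by linarith, by linarith⟩
    have hψx : ψ (y t) * deriv x t ≤ s * (1 + 2 * B) := by
      obtain ⟨h0, h1⟩ := hψ (y t)
      have hle := le_abs_self (deriv x t)
      have hnn := abs_nonneg (deriv x t)
      nlinarith
    have hx2 := sq_le_sq' (neg_le_of_abs_le hxb) (le_of_abs_le hxb)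
    have hy2 := sq_le_sq' (neg_le_of_abs_le hyb) (le_of_abs_le hyb)
    refine le_trans ?_ (le_abs_self K)
    simp only [hE, hK]
    linarith
  have hbottom : ∀ t ∈ Set.Ioo 0 N, E t ≤ 2 * k := by
    rintro t ⟨-, ht⟩
    have hy0 : y t = 0 := by
      simp only [hy]
      rw [Real.smoothTransition.zero_of_nonpos (by linarith),
        Real.smoothTransition.zero_of_nonpos (by linarith)]
      ring
    simp only [hE]
    rw [hx', hy', hy0, hψ0, deriv_turn_of_neg (by linarith), deriv_turn_of_neg (by linarith),
      deriv_smoothTransition_of_neg (by linarith), deriv_smoothTransition_of_neg (by linarith)]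
    linarith
  have htop : ∀ t ∈ Set.Ioo (N + 1) (2 * N + 1), E t ≤ 2 * k - s := by
    rintro t ⟨ht, ht'⟩
    have hy1 : y t = 1 / 2 := by
      simp only [hy]
      rw [Real.smoothTransition.one_of_one_le (by linarith),
        Real.smoothTransition.zero_of_nonpos (by linarith)]
      ring
    simp only [hE]
    rw [hx', hy', hy1, hψhalf, deriv_turn_of_one_lt (by linarith), deriv_turn_of_neg (by linarith),
      deriv_smoothTransition_of_one_lt (by linarith), deriv_smoothTransition_of_neg (by linarith)]
    linarith
  have hI (a b : ℝ) : IntervalIntegrable E volume a b := hEc.intervalIntegrable a b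
  have h1 := intervalIntegral_le_const_mul hEc hN0.le hbottom
  have h2 := intervalIntegral_le_const_mul hEc (by linarith : N ≤ N + 1) fun t _ => hEK t
  have h3 := intervalIntegral_le_const_mul hEc (by linarith : N + 1 ≤ 2 * N + 1) htop
  have h4 := intervalIntegral_le_const_mul hEc (by linarith : 2 * N + 1 ≤ 2 * N + 2)
    fun t _ => hEK t
  rw [← intervalIntegral.integral_add_adjacent_intervals (hI 0 (2 * N + 1)) (hI _ _),
    ← intervalIntegral.integral_add_adjacent_intervals (hI 0 (N + 1)) (hI _ _),
    ← intervalIntegral.integral_add_adjacent_intervals (hI 0 N) (hI _ _)]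
  linarith
end

section
/- Let ψ : ℝ → ℝ be C¹ with 0 ≤ ψ(s) ≤ 1 for all s, and let x, y : ℝ → ℝ be twice differentiable functions satisfying x''(t) = −ψ'(y(t))·y'(t) and y''(t) = ψ'(y(t))·x'(t) for all t ∈ ℝ. Let k := ½(x'(0)² + y'(0)²) and assume k < 1/8 and ψ(y(0)) = 0. Then ψ(y(t)) < 1 for all t ∈ ℝ. -/
/-- For the magnetic Lagrangian `L((x,y),(v₁,v₂)) = ½(v₁² + v₂²) + ψ(y)v₁` on `ℝ²` with
`0 ≤ ψ ≤ 1`: an Euler–Lagrange orbit of energy `k = ½(x'(0)² + y'(0)²) < 1/8` starting at a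
point where `ψ(y) = 0` never reaches a level where `ψ(y) = 1`. -/
theorem orbit_of_subcritical_energy_stays_below_psi_one
    (ψ : ℝ → ℝ) (hψ : ContDiff ℝ 1 ψ) (hψ01 : ∀ s, 0 ≤ ψ s ∧ ψ s ≤ 1)
    (x y : ℝ → ℝ)
    (hx : Differentiable ℝ x) (hx' : Differentiable ℝ (deriv x))
    (hy : Differentiable ℝ y) (hy' : Differentiable ℝ (deriv y))
    (hELx : ∀ t, deriv (deriv x) t = -(deriv ψ (y t)) * deriv y t)
    (hELy : ∀ t, deriv (deriv y) t = deriv ψ (y t) * deriv x t)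
    (hk : 1 / 2 * ((deriv x 0) ^ 2 + (deriv y 0) ^ 2) < 1 / 8)
    (hψy0 : ψ (y 0) = 0) :
    ∀ t : ℝ, ψ (y t) < 1 := by
  have hψd : ∀ s, HasDerivAt ψ (deriv ψ s) s := fun s =>
    ((hψ.differentiable one_ne_zero) s).hasDerivAt
  have momentum_hasDerivAt : ∀ t, HasDerivAt (fun t => deriv x t + ψ (y t)) 0 t := fun t => by
    have h := (hx' t).hasDerivAt.add ((hψd (y t)).comp t (hy t).hasDerivAt)
    rw [hELx t] at h
    exact h.congr_deriv (by ring)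
  have energy_hasDerivAt : ∀ t, HasDerivAt (fun t => deriv x t ^ 2 + deriv y t ^ 2) 0 t :=
    fun t => by
      have h := ((hx' t).hasDerivAt.pow 2).add ((hy' t).hasDerivAt.pow 2)
      rw [hELx t, hELy t] at h
      exact h.congr_deriv (by ring)
  intro t
  have momentum_eq : deriv x t + ψ (y t) = deriv x 0 + ψ (y 0) :=
    is_const_of_deriv_eq_zero (fun s => (momentum_hasDerivAt s).differentiableAt)
      (fun s => (momentum_hasDerivAt s).deriv) t 0
  have energy_eq : deriv x t ^ 2 + deriv y t ^ 2 = deriv x 0 ^ 2 + deriv y 0 ^ 2 :=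
    is_const_of_deriv_eq_zero (fun s => (energy_hasDerivAt s).differentiableAt)
      (fun s => (energy_hasDerivAt s).deriv) t 0
  have hx0 : deriv x 0 < 1 / 2 := by nlinarith [sq_nonneg (deriv y 0)]
  have hxt : -(1 / 2) < deriv x t := by nlinarith [sq_nonneg (deriv y t)]
  linarith
end

section
/- Let ψ : ℝ → ℝ be C² with 0 ≤ ψ(s) ≤ 1 for all s, and suppose ψ'(s) = 0 whenever ψ(s) = 1. Let x, y : ℝ → ℝ be twice differentiable functions satisfying x''(t) = −ψ'(y(t))·y'(t) and y''(t) = ψ'(y(t))·x'(t) for all t ∈ ℝ, with x'(0)² + y'(0)² = 1/4 (i.e. energy exactly 1/8) and ψ(y(0)) = 0. Then ψ(y(t)) < 1 for all t ∈ ℝ. -/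
/-- Two global solutions of an autonomous ODE with locally Lipschitz right-hand side that agree at
one time agree at all times. -/
theorem LocallyLipschitz.eq_of_hasDerivAt {E : Type*} [NormedAddCommGroup E] [NormedSpace ℝ E]
    {v : E → E} (hv : LocallyLipschitz v) {f g : ℝ → E} (hf : ∀ t, HasDerivAt f (v (f t)) t)
    (hg : ∀ t, HasDerivAt g (v (g t)) t) {t₀ : ℝ} (h : f t₀ = g t₀) : f = g := by
  ext t
  obtain ⟨a, b, ht, ht₀⟩ : ∃ a b, t ∈ Set.Ioo a b ∧ t₀ ∈ Set.Ioo a b := by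
    use min t t₀ - 1, max t t₀ + 1
    grind
  have hfc : Continuous f := continuous_iff_continuousAt.2 fun s => (hf s).continuousAt
  have hgc : Continuous g := continuous_iff_continuousAt.2 fun s => (hg s).continuousAt
  obtain ⟨K, hK⟩ := (hv.locallyLipschitzOn
    (s := f '' Set.Icc a b ∪ g '' Set.Icc a b)).exists_lipschitzOnWith_of_compact
    ((isCompact_Icc.image hfc).union (isCompact_Icc.image hgc))
  exact ODE_solution_unique_of_mem_Ioo (v := fun _ => v) (fun _ _ => hK) ht₀
    (fun s hs => ⟨hf s, Or.inl ⟨s, Set.Ioo_subset_Icc_self hs, rfl⟩⟩)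
    (fun s hs => ⟨hg s, Or.inr ⟨s, Set.Ioo_subset_Icc_self hs, rfl⟩⟩) h ht

/-- The borderline case `k = 1/8 = c_u(L)` for the magnetic Lagrangian
`L((x,y),(v₁,v₂)) = ½(v₁² + v₂²) + ψ(y)v₁` on `ℝ²` with `0 ≤ ψ ≤ 1` and `ψ' = 0` on
`{ψ = 1}`: an Euler–Lagrange orbit of energy exactly `1/8` starting at a point where
`ψ(y) = 0` never reaches a level where `ψ(y) = 1`. -/
theorem orbit_of_critical_energy_stays_below_psi_one
    (ψ : ℝ → ℝ) (hψ : ContDiff ℝ 2 ψ) (hψ01 : ∀ s, 0 ≤ ψ s ∧ ψ s ≤ 1)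
    (hψ' : ∀ s, ψ s = 1 → deriv ψ s = 0)
    (x y : ℝ → ℝ)
    (hx : Differentiable ℝ x) (hx' : Differentiable ℝ (deriv x))
    (hy : Differentiable ℝ y) (hy' : Differentiable ℝ (deriv y))
    (hELx : ∀ t, deriv (deriv x) t = -(deriv ψ (y t)) * deriv y t)
    (hELy : ∀ t, deriv (deriv y) t = deriv ψ (y t) * deriv x t)
    (hk : (deriv x 0) ^ 2 + (deriv y 0) ^ 2 = 1 / 4)
    (hψy0 : ψ (y 0) = 0) :
    ∀ t : ℝ, ψ (y t) < 1 := by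
  have hψd : Differentiable ℝ ψ := hψ.differentiable (by norm_num)
  have hψ1 : ContDiff ℝ 1 (deriv ψ) := hψ.deriv' (n := 1)
  have hψy (t : ℝ) : HasDerivAt (fun s => ψ (y s)) (deriv ψ (y t) * deriv y t) t :=
    (hψd (y t)).hasDerivAt.comp t (hy t).hasDerivAt
  have momentum (t : ℝ) : deriv x t + ψ (y t) = deriv x 0 := by
    have hd (s : ℝ) : HasDerivAt (fun s => deriv x s + ψ (y s)) 0 s := by
      refine ((hx' s).hasDerivAt.add (hψy s)).congr_deriv ?_
      rw [hELx]; ring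
    simpa [hψy0] using is_const_of_deriv_eq_zero (fun s => (hd s).differentiableAt)
      (fun s => (hd s).deriv) t 0
  have energy (t : ℝ) : deriv x t ^ 2 + deriv y t ^ 2 = 1 / 4 := by
    have hd (s : ℝ) : HasDerivAt (fun s => deriv x s ^ 2 + deriv y s ^ 2) 0 s := by
      refine (((hx' s).hasDerivAt.pow 2).add ((hy' s).hasDerivAt.pow 2)).congr_deriv ?_
      rw [hELx, hELy]; ring
    rw [← hk]
    exact is_const_of_deriv_eq_zero (fun s => (hd s).differentiableAt) (fun s => (hd s).deriv) t 0
  intro t₀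
  refine lt_of_le_of_ne (hψ01 _).2 fun h1 => ?_
  have hy0 : deriv y t₀ = 0 := by
    have hm := momentum t₀
    have he := energy t₀
    rw [h1] at hm
    have : deriv y t₀ ^ 2 = 0 := by
      nlinarith [sq_nonneg (deriv y t₀), sq_nonneg (deriv y 0), sq_nonneg (deriv x 0 + deriv x t₀)]
    simpa using this
  let v : ℝ × ℝ → ℝ × ℝ := fun p => (p.2, deriv ψ p.1 * (deriv x 0 - ψ p.1))
  have hv : ContDiff ℝ 1 v :=
    contDiff_snd.prodMk ((hψ1.comp contDiff_fst).mul
      (contDiff_const.sub ((hψ.of_le (by norm_num)).comp contDiff_fst)))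
  have hsol (t : ℝ) : HasDerivAt (fun s => (y s, deriv y s)) (v (y t, deriv y t)) t := by
    have hacc : deriv (deriv y) t = deriv ψ (y t) * (deriv x 0 - ψ (y t)) := by
      rw [hELy, ← momentum t]; ring
    exact (hy t).hasDerivAt.prodMk (hacc ▸ (hy' t).hasDerivAt)
  have hconst (t : ℝ) : HasDerivAt (fun _ => (y t₀, (0 : ℝ))) (v (y t₀, 0)) t := by
    have hzero : v (y t₀, 0) = 0 := by simp [v, hψ' _ h1]
    rw [hzero]
    exact hasDerivAt_const t _
  have heq := congrFun (hv.locallyLipschitz.eq_of_hasDerivAt hsol hconst (t₀ := t₀)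
    (by simp [hy0])) 0
  have : y 0 = y t₀ := congrArg Prod.fst heq
  rw [this, h1] at hψy0
  exact one_ne_zero hψy0
end

section
/- For every k < 1/2 there exist T > 0 and a C¹ loop γ = (γ₁, γ₂) : [0,T] → ℝ × (0,∞) with γ(0) = γ(T) such that ∫₀ᵀ [ (γ₁'(t)² + γ₂'(t)²)/(2γ₂(t)²) + γ₁'(t)/γ₂(t) + k ] dt < 0. -/
open MeasureTheory

section HorocycleCircle

open Real Filter Topology

lemma cos_sq_add_mul_sin_sq_pos {E : ℝ} (hE : 1 < E) (a : ℝ) :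
    0 < cos a ^ 2 + E ^ 2 * sin a ^ 2 := by
  have hE2 : 0 < E ^ 2 - 1 := by nlinarith
  nlinarith [sin_sq_add_cos_sq a, mul_nonneg hE2.le (sq_nonneg (sin a))]

/-- First coordinate of the rotation orbit of `E * I`: a clockwise parametrization of the
hyperbolic circle with centre `I` and radius `log E`. -/
noncomputable def circleFst (E a : ℝ) : ℝ :=
  (E ^ 2 - 1) * (sin a * cos a) / (cos a ^ 2 + E ^ 2 * sin a ^ 2)

/-- Second coordinate of the rotation orbit of `E * I`. -/
noncomputable def circleSnd (E a : ℝ) : ℝ := E / (cos a ^ 2 + E ^ 2 * sin a ^ 2)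

lemma contDiff_circleFst {E : ℝ} (hE : 1 < E) : ContDiff ℝ 1 (circleFst E) :=
  ContDiff.div (by fun_prop) (by fun_prop) fun a => (cos_sq_add_mul_sin_sq_pos hE a).ne'

lemma contDiff_circleSnd {E : ℝ} (hE : 1 < E) : ContDiff ℝ 1 (circleSnd E) :=
  ContDiff.div (by fun_prop) (by fun_prop) fun a => (cos_sq_add_mul_sin_sq_pos hE a).ne'

lemma hasDerivAt_cos_sq_add_mul_sin_sq (E a : ℝ) :
    HasDerivAt (fun a => cos a ^ 2 + E ^ 2 * sin a ^ 2)
      (2 * (E ^ 2 - 1) * (sin a * cos a)) a := by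
  refine (((hasDerivAt_cos a).pow 2).add
    (((hasDerivAt_sin a).pow 2).const_mul (E ^ 2))).congr_deriv ?_
  norm_num
  ring

lemma hasDerivAt_circleFst {E : ℝ} (hE : 1 < E) (a : ℝ) :
    HasDerivAt (circleFst E)
      ((E ^ 2 - 1) * (cos a ^ 2 - E ^ 2 * sin a ^ 2) /
        (cos a ^ 2 + E ^ 2 * sin a ^ 2) ^ 2) a := by
  refine ((((hasDerivAt_sin a).mul (hasDerivAt_cos a)).const_mul (E ^ 2 - 1)).div
    (hasDerivAt_cos_sq_add_mul_sin_sq E a)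
    (cos_sq_add_mul_sin_sq_pos hE a).ne').congr_deriv ?_
  congr 1
  simp only [Pi.mul_apply]
  linear_combination (E ^ 2 - 1) * (cos a ^ 2 - E ^ 2 * sin a ^ 2) * sin_sq_add_cos_sq a

lemma hasDerivAt_circleSnd {E : ℝ} (hE : 1 < E) (a : ℝ) :
    HasDerivAt (circleSnd E)
      (-(2 * E * (E ^ 2 - 1) * (sin a * cos a)) /
        (cos a ^ 2 + E ^ 2 * sin a ^ 2) ^ 2) a := by
  refine ((hasDerivAt_const a E).div (hasDerivAt_cos_sq_add_mul_sin_sq E a)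
    (cos_sq_add_mul_sin_sq_pos hE a).ne').congr_deriv ?_
  congr 1
  ring

/-- The Lagrangian along the circle parametrized by arc length. -/
lemma lagrangian_circle {E : ℝ} (hE : 1 < E) (k t : ℝ) :
    ((deriv (fun t => circleFst E (E / (E ^ 2 - 1) * t)) t) ^ 2
        + (deriv (fun t => circleSnd E (E / (E ^ 2 - 1) * t)) t) ^ 2)
          / (2 * circleSnd E (E / (E ^ 2 - 1) * t) ^ 2)
      + deriv (fun t => circleFst E (E / (E ^ 2 - 1) * t)) t
          / circleSnd E (E / (E ^ 2 - 1) * t) + k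
    = k - 1 / 2 + 2 * (cos (E / (E ^ 2 - 1) * t) ^ 2 /
        (cos (E / (E ^ 2 - 1) * t) ^ 2 + E ^ 2 * sin (E / (E ^ 2 - 1) * t) ^ 2)) := by
  have hm : HasDerivAt (fun t => E / (E ^ 2 - 1) * t) (E / (E ^ 2 - 1)) t := by
    simpa using (hasDerivAt_id t).const_mul (E / (E ^ 2 - 1))
  have h₁ := ((hasDerivAt_circleFst hE (E / (E ^ 2 - 1) * t)).comp t hm).deriv
  have h₂ := ((hasDerivAt_circleSnd hE (E / (E ^ 2 - 1) * t)).comp t hm).deriv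
  simp only [Function.comp_def] at h₁ h₂
  rw [h₁, h₂, circleSnd]
  generalize E / (E ^ 2 - 1) * t = a
  have hD := cos_sq_add_mul_sin_sq_pos hE a
  have hs := sin_sq_add_cos_sq a
  have hM : E ^ 2 - 1 ≠ 0 := by nlinarith
  have hE₀ : E ≠ 0 := by linarith
  set D := cos a ^ 2 + E ^ 2 * sin a ^ 2 with hDdef
  have hkin : ((E ^ 2 - 1) * (cos a ^ 2 - E ^ 2 * sin a ^ 2) / D ^ 2 * (E / (E ^ 2 - 1))) ^ 2
      + (-(2 * E * (E ^ 2 - 1) * (sin a * cos a)) / D ^ 2 * (E / (E ^ 2 - 1))) ^ 2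
      = E ^ 2 / D ^ 2 := by
    have : (cos a ^ 2 - E ^ 2 * sin a ^ 2) ^ 2 + (2 * E * (sin a * cos a)) ^ 2 = D ^ 2 := by
      rw [hDdef]; ring
    field_simp
    linear_combination this
  rw [hkin]
  field_simp
  rw [hDdef]
  ring

lemma tendsto_integral_cos_sq_div :
    Tendsto (fun E : ℝ => ∫ a in (0:ℝ)..π, cos a ^ 2 / (cos a ^ 2 + E ^ 2 * sin a ^ 2))
      atTop (𝓝 0) := by
  have h := intervalIntegral.tendsto_integral_filter_of_dominated_convergence
    (μ := volume) (a := 0) (b := π) (l := atTop)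
    (F := fun E a : ℝ => cos a ^ 2 / (cos a ^ 2 + E ^ 2 * sin a ^ 2)) (f := fun _ => 0)
    (fun _ => 1) ?_ ?_ (by simp) ?_
  · simpa using h
  · exact Eventually.of_forall fun E => (by fun_prop : Measurable fun a : ℝ =>
      cos a ^ 2 / (cos a ^ 2 + E ^ 2 * sin a ^ 2)).aestronglyMeasurable
  · refine Eventually.of_forall fun E => ae_of_all _ fun a _ => ?_
    rw [Real.norm_of_nonneg (by positivity)]
    exact div_le_one_of_le₀ (le_add_of_nonneg_right (by positivity)) (by positivity)
  · filter_upwards [Measure.ae_ne volume π] with a ha hmem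
    rw [Set.uIoc_of_le pi_pos.le] at hmem
    have hsin : 0 < sin a := sin_pos_of_pos_of_lt_pi hmem.1 (lt_of_le_of_ne hmem.2 ha)
    refine Tendsto.const_div_atTop (tendsto_atTop_add_const_left _ _ ?_) _
    exact (tendsto_pow_atTop two_ne_zero).atTop_mul_const (by positivity)

end HorocycleCircle

/-- For the horocycle Lagrangian `L(q,v) = ½|v|²_g + θ_q(v)` on the hyperbolic upper
half-plane, for every `k < 1/2` there is a `C¹` loop in the upper half-plane with
negative `(L+k)`-action: the bound `c(L) ≥ 1/2`. -/
theorem horocycle_exists_loop_with_negative_action_of_k_lt_one_half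
    (k : ℝ) (hk : k < 1 / 2) :
    ∃ (T : ℝ) (_ : 0 < T) (γ₁ γ₂ : ℝ → ℝ) (_ : ContDiff ℝ 1 γ₁) (_ : ContDiff ℝ 1 γ₂)
      (_ : ∀ t ∈ Set.Icc (0:ℝ) T, 0 < γ₂ t) (_ : γ₁ 0 = γ₁ T) (_ : γ₂ 0 = γ₂ T),
      (∫ t in (0:ℝ)..T,
        (((deriv γ₁ t) ^ 2 + (deriv γ₂ t) ^ 2) / (2 * (γ₂ t) ^ 2)
          + deriv γ₁ t / γ₂ t + k)) < 0 := by
  have hc : 0 < (1 / 2 - k) * Real.pi / 2 := by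
    have := Real.pi_pos
    have : 0 < 1 / 2 - k := by linarith
    positivity
  obtain ⟨E, hint, hE⟩ := ((tendsto_integral_cos_sq_div.eventually_lt_const hc).and
    (Filter.eventually_gt_atTop 1)).exists
  have hl : 0 < E / (E ^ 2 - 1) := div_pos (by linarith) (by nlinarith)
  have hT : E / (E ^ 2 - 1) * (Real.pi / (E / (E ^ 2 - 1))) = Real.pi :=
    mul_div_cancel₀ _ hl.ne'
  refine ⟨Real.pi / (E / (E ^ 2 - 1)), div_pos Real.pi_pos hl,
    fun t => circleFst E (E / (E ^ 2 - 1) * t), fun t => circleSnd E (E / (E ^ 2 - 1) * t),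
    (contDiff_circleFst hE).comp (by fun_prop), (contDiff_circleSnd hE).comp (by fun_prop),
    fun t _ => div_pos (by linarith) (cos_sq_add_mul_sin_sq_pos hE _), ?_, ?_, ?_⟩
  · simp only [hT]
    simp [circleFst]
  · simp only [hT]
    simp [circleSnd]
  simp only [lagrangian_circle hE]
  rw [intervalIntegral.integral_comp_mul_left (fun a => k - 1 / 2 +
    2 * (Real.cos a ^ 2 / (Real.cos a ^ 2 + E ^ 2 * Real.sin a ^ 2))) hl.ne', hT, mul_zero,
    smul_eq_mul]
  refine mul_neg_of_pos_of_neg (inv_pos.2 hl) ?_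
  have hcont : Continuous fun a : ℝ =>
      2 * (Real.cos a ^ 2 / (Real.cos a ^ 2 + E ^ 2 * Real.sin a ^ 2)) :=
    continuous_const.mul (Continuous.div (by fun_prop) (by fun_prop)
      fun a => (cos_sq_add_mul_sin_sq_pos hE a).ne')
  rw [intervalIntegral.integral_add (by simp) (hcont.intervalIntegrable _ _),
    intervalIntegral.integral_const, intervalIntegral.integral_const_mul, smul_eq_mul]
  linarith
end
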